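/- The codimension order co(G(4,2,4)) is not a ranked poset: there is no function r from G(4,2,4) to the integers such that r(v) = r(u) + 1 for every covering relation u ⋖ v of co(G(4,2,4)). -/

import Mathlib

open Module Set

noncomputable section

variable {V : Type*} [AddCommGroup V] [Module ℂ V]

/-- The codimension of the fixed subspace of a linear automorphism. -/
def fixCodim (w : V ≃ₗ[ℂ] V) : ℕ :=
  finrank ℂ V - finrank ℂ (LinearMap.ker ((w : V →ₗ[ℂ] V) - 1))

/-- A reflection: fixed space has codimension one. -/
def IsReflection (w : V ≃ₗ[ℂ] V) : Prop := fixCodim w = 1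

/-- A finite subgroup of GL(V) generated by its reflections. -/
def IsComplexReflectionGroup (W : Set (V ≃ₗ[ℂ] V)) : Prop :=
  W.Finite ∧ W = (Subgroup.closure {t | t ∈ W ∧ IsReflection t} : Subgroup (V ≃ₗ[ℂ] V))

/-- Reflection length with respect to the reflections of `W`. -/
def reflLen (W : Set (V ≃ₗ[ℂ] V)) (w : V ≃ₗ[ℂ] V) : ℕ :=
  sInf {k | ∃ l : List (V ≃ₗ[ℂ] V), l.length = k ∧
    (∀ t ∈ l, t ∈ W ∧ IsReflection t) ∧ l.prod = w}

/-- The prefix order relation. -/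
def preLe (W : Set (V ≃ₗ[ℂ] V)) (u v : V ≃ₗ[ℂ] V) : Prop :=
  reflLen W u + reflLen W (u⁻¹ * v) = reflLen W v

/-- The codimension order relation. -/
def coLe (u v : V ≃ₗ[ℂ] V) : Prop :=
  fixCodim u + fixCodim (u⁻¹ * v) = fixCodim v

/-- The group `G(m,p,n)` of monomial matrices with `m`-th root of unity entries whose
product is an `(m/p)`-th root of unity, as linear automorphisms of `ℂⁿ`. -/
def Gmpn (m p n : ℕ) : Set ((Fin n → ℂ) ≃ₗ[ℂ] (Fin n → ℂ)) :=
  {w | ∃ (σ : Equiv.Perm (Fin n)) (a : Fin n → ℂ),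
    (∀ i, a i ^ m = 1) ∧ (∏ i, a i) ^ (m / p) = 1 ∧
    ∀ j, w (Pi.single j (1 : ℂ)) = a j • (Pi.single (σ j) (1 : ℂ) : Fin n → ℂ)}

section Poset

variable {α : Type*}

/-- An antichain of the poset on carrier `P` with order relation `le`. -/
def IsAntichainOn (P : Set α) (le : α → α → Prop) (A : Set α) : Prop :=
  A ⊆ P ∧ ∀ x ∈ A, ∀ y ∈ A, x ≠ y → ¬ le x y ∧ ¬ le y x

/-- `k`-Sperner: no union of `k` antichains is larger than the union of some `k` ranks
(equivalently, of the `k` largest ranks). -/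
def IsKSpernerOn (P : Set α) (le : α → α → Prop) (rk : α → ℕ) (k : ℕ) : Prop :=
  ∀ 𝒜 : Fin k → Set α, (∀ i, IsAntichainOn P le (𝒜 i)) →
    ∃ S : Finset ℕ, S.card ≤ k ∧ (⋃ i, 𝒜 i).ncard ≤ {x | x ∈ P ∧ rk x ∈ S}.ncard

def IsStronglySpernerOn (P : Set α) (le : α → α → Prop) (rk : α → ℕ) : Prop :=
  ∀ k, IsKSpernerOn P le rk k

/-- Sperner: no antichain is larger than some (equivalently, the largest) rank. -/
def IsSpernerOn (P : Set α) (le : α → α → Prop) (rk : α → ℕ) : Prop :=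
  ∀ A : Set α, IsAntichainOn P le A → ∃ i, A.ncard ≤ {x | x ∈ P ∧ rk x = i}.ncard

/-- Covering relation of the poset on carrier `P`. -/
def CoversOn (P : Set α) (le : α → α → Prop) (x y : α) : Prop :=
  x ∈ P ∧ y ∈ P ∧ le x y ∧ x ≠ y ∧ ∀ z ∈ P, le x z → le z y → z = x ∨ z = y

/-- A normalized flow on the bipartite graph with parts `A`, `B`, edge relation `E`
and vertex weights `ν`. -/
def IsNormalizedFlowBetween (A B : Set α) (E : α → α → Prop) (ν : α → ℝ)
    (f : α → α → ℝ) : Prop :=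
  (∀ a b, 0 ≤ f a b) ∧
  (∀ a b, f a b ≠ 0 → a ∈ A ∧ b ∈ B ∧ E a b) ∧
  (∀ a ∈ A, (∑ᶠ b ∈ B, f a b) = ν a / ∑ᶠ x ∈ A, ν x) ∧
  (∀ b ∈ B, (∑ᶠ a ∈ A, f a b) = ν b / ∑ᶠ x ∈ B, ν x)

/-- A ranked poset has a normalized flow if each bipartite graph of covering relations
between consecutive ranks admits one. -/
def HasNormalizedFlowOn (P : Set α) (le : α → α → Prop) (rk : α → ℕ) (ν : α → ℝ) : Prop :=
  ∀ i : ℕ, ∃ f, IsNormalizedFlowBetween {x | x ∈ P ∧ rk x = i} {x | x ∈ P ∧ rk x = i + 1}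
    (CoversOn P le) ν f

end Poset


theorem fixCodim_eq_finrank {w : V ≃ₗ[ℂ] V} (h : ∀ x, w x = x → x = 0) :
    fixCodim w = finrank ℂ V := by
  have hker : LinearMap.ker ((w : V →ₗ[ℂ] V) - 1) = ⊥ :=
    LinearMap.ker_eq_bot'.2 fun x hx => h x (sub_eq_zero.1 hx)
  rw [fixCodim, hker, finrank_bot, Nat.sub_zero]

section FixCodim

variable [FiniteDimensional ℂ V]

theorem fixCodim_eq_finrank_range (w : V ≃ₗ[ℂ] V) :
    fixCodim w = finrank ℂ (LinearMap.range ((w : V →ₗ[ℂ] V) - 1)) := by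
  have h := LinearMap.finrank_range_add_finrank_ker ((w : V →ₗ[ℂ] V) - 1)
  unfold fixCodim
  omega

theorem eq_one_of_fixCodim_eq_zero {w : V ≃ₗ[ℂ] V} (h : fixCodim w = 0) : w = 1 := by
  rw [fixCodim_eq_finrank_range, Submodule.finrank_eq_zero, LinearMap.range_eq_bot,
    sub_eq_zero] at h
  ext x
  exact LinearMap.congr_fun h x

theorem fixCodim_one : fixCodim (1 : V ≃ₗ[ℂ] V) = 0 := by
  have h : (((1 : V ≃ₗ[ℂ] V) : V →ₗ[ℂ] V) - 1) = 0 := by ext; simp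
  rw [fixCodim_eq_finrank_range, h, LinearMap.range_zero, finrank_bot]

theorem fixCodim_mul_le (a b : V ≃ₗ[ℂ] V) : fixCodim (a * b) ≤ fixCodim a + fixCodim b := by
  simp only [fixCodim_eq_finrank_range]
  refine le_trans (Submodule.finrank_mono ?_) (Submodule.finrank_add_le_finrank_add_finrank _ _)
  rintro _ ⟨x, rfl⟩
  refine Submodule.mem_sup.2 ⟨_, ⟨b x, rfl⟩, _, ⟨x, rfl⟩, ?_⟩
  simp

theorem fixCodim_le_card {w : V ≃ₗ[ℂ] V} (s : Finset V)
    (h : ∀ x, w x - x ∈ Submodule.span ℂ (s : Set V)) : fixCodim w ≤ s.card := by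
  rw [fixCodim_eq_finrank_range]
  refine le_trans (Submodule.finrank_mono ?_) (finrank_span_finset_le_card s)
  rintro _ ⟨x, rfl⟩
  exact h x

/-- The trace of a reflection is determined by its determinant. -/
theorem IsReflection.trace_eq {w : V ≃ₗ[ℂ] V} (h : IsReflection w) :
    LinearMap.trace ℂ V w = finrank ℂ V - 1 + LinearMap.det (w : V →ₗ[ℂ] V) := by
  have hw : w ∈ LinearEquiv.dilatransvections ℂ V := by
    rw [LinearEquiv.mem_dilatransvections_iff_finrank]
    exact ((fixCodim_eq_finrank_range w).symm.trans h).le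
  obtain ⟨f, x, hfx⟩ := hw
  have h₁ : LinearMap.transvection f x = 1 + f.smulRight x := by
    ext y
    simp [LinearMap.transvection]
  have h₂ : LinearMap.trace ℂ V w = finrank ℂ V + f x := by
    rw [hfx, h₁, map_add, LinearMap.trace_one, LinearMap.trace_smulRight]
  rw [h₂, hfx, LinearMap.transvection.det]
  ring

end FixCodim

section Monomial

variable {m p n : ℕ}

theorem Gmpn.mul_mem {v w : (Fin n → ℂ) ≃ₗ[ℂ] (Fin n → ℂ)} (hv : v ∈ Gmpn m p n)
    (hw : w ∈ Gmpn m p n) : v * w ∈ Gmpn m p n := by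
  obtain ⟨σ, a, ha, ha', hv⟩ := hv
  obtain ⟨τ, b, hb, hb', hw⟩ := hw
  refine ⟨σ * τ, fun j => b j * a (τ j), fun i => ?_, ?_, fun j => ?_⟩
  · rw [mul_pow, ha, hb, one_mul]
  · rw [Finset.prod_mul_distrib, Equiv.prod_comp τ a, mul_pow, ha', hb', one_mul]
  · rw [LinearEquiv.mul_apply, hw, map_smul, hv, smul_smul, Equiv.Perm.mul_apply]

theorem Gmpn.inv_mem (hm : m ≠ 0) {v : (Fin n → ℂ) ≃ₗ[ℂ] (Fin n → ℂ)} (hv : v ∈ Gmpn m p n) :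
    v⁻¹ ∈ Gmpn m p n := by
  obtain ⟨σ, a, ha, ha', hv⟩ := hv
  have h0 : ∀ i, a i ≠ 0 := fun i h => by simpa [h, hm] using ha i
  refine ⟨σ⁻¹, fun j => (a (σ⁻¹ j))⁻¹, fun i => ?_, ?_, fun j => ?_⟩
  · rw [inv_pow, ha, inv_one]
  · rw [Equiv.prod_comp σ⁻¹ fun i => (a i)⁻¹, Finset.prod_inv_distrib, inv_pow, ha', inv_one]
  · apply v.injective
    rw [← LinearEquiv.mul_apply, mul_inv_cancel, LinearEquiv.coe_one, id, map_smul, hv, smul_smul,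
      inv_mul_cancel₀ (h0 _), one_smul, ← Equiv.Perm.mul_apply, mul_inv_cancel, Equiv.Perm.coe_one, id]

theorem toMatrix'_monomial {f : (Fin n → ℂ) →ₗ[ℂ] (Fin n → ℂ)} {σ : Equiv.Perm (Fin n)}
    {a : Fin n → ℂ}
    (h : ∀ j, f (Pi.single j (1 : ℂ)) = a j • (Pi.single (σ j) (1 : ℂ) : Fin n → ℂ)) :
    LinearMap.toMatrix' f =
      Matrix.of fun i j => a j * (1 : Matrix (Fin n) (Fin n) ℂ).submatrix id σ i j := by
  ext i j
  simp [LinearMap.toMatrix'_apply, h, Matrix.one_apply, Pi.single_apply]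

theorem det_monomial {f : (Fin n → ℂ) →ₗ[ℂ] (Fin n → ℂ)} {σ : Equiv.Perm (Fin n)}
    {a : Fin n → ℂ}
    (h : ∀ j, f (Pi.single j (1 : ℂ)) = a j • (Pi.single (σ j) (1 : ℂ) : Fin n → ℂ)) :
    LinearMap.det f = (∏ i, a i) * (Equiv.Perm.sign σ : ℤ) := by
  rw [← LinearMap.det_toMatrix', toMatrix'_monomial h, Matrix.det_mul_row, Matrix.det_permute',
    Matrix.det_one, mul_one]

theorem trace_monomial {f : (Fin n → ℂ) →ₗ[ℂ] (Fin n → ℂ)} {σ : Equiv.Perm (Fin n)}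
    {a : Fin n → ℂ}
    (h : ∀ j, f (Pi.single j (1 : ℂ)) = a j • (Pi.single (σ j) (1 : ℂ) : Fin n → ℂ)) :
    LinearMap.trace ℂ _ f = ∑ j, if j = σ j then a j else 0 := by
  rw [LinearMap.trace_eq_matrix_trace ℂ (Pi.basisFun ℂ (Fin n)), LinearMap.toMatrix_eq_toMatrix',
    toMatrix'_monomial h, Matrix.trace]
  simp [Matrix.one_apply]

theorem Gmpn.eq_one_of_trace_eq (hm : m ≠ 0) {w : (Fin n → ℂ) ≃ₗ[ℂ] (Fin n → ℂ)}
    (hw : w ∈ Gmpn m p n)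
    (h : LinearMap.trace ℂ _ (w : (Fin n → ℂ) →ₗ[ℂ] (Fin n → ℂ)) = n) : w = 1 := by
  obtain ⟨σ, a, ha, -, hw⟩ := hw
  rw [trace_monomial (f := (w : (Fin n → ℂ) →ₗ[ℂ] (Fin n → ℂ))) hw] at h
  have hnorm : ∀ j, ‖a j‖ = 1 := fun j => Complex.norm_eq_one_of_pow_eq_one (ha j) hm
  have hle : ∀ j, (if j = σ j then a j else 0).re ≤ 1 := fun j => by
    split_ifs
    · exact (Complex.re_le_norm _).trans (hnorm j).le
    · simp
  have hsum : ∑ j, (if j = σ j then a j else 0).re = ∑ _j : Fin n, (1 : ℝ) := by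
    rw [← Complex.re_sum, h]
    simp
  have heq := (Finset.sum_eq_sum_iff_of_le fun j _ => hle j).1 hsum
  have hfix : ∀ j, j = σ j ∧ a j = 1 := fun j => by
    have hj := heq j (Finset.mem_univ j)
    split_ifs at hj with hσ
    · have hsq := Complex.sq_norm (a j)
      rw [hnorm, Complex.normSq_apply, hj] at hsq
      exact ⟨hσ, Complex.ext hj (by simpa using hsq)⟩
    · simp at hj
  refine LinearEquiv.toLinearMap_injective ((Pi.basisFun ℂ (Fin n)).ext fun j => ?_)
  simp [hw, ← (hfix j).1, (hfix j).2]

/-- Every reflection in `G(4,2,4)` has determinant `-1`. -/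
theorem Gmpn.det_eq_neg_one {w : (Fin 4 → ℂ) ≃ₗ[ℂ] (Fin 4 → ℂ)} (hw : w ∈ Gmpn 4 2 4)
    (h : IsReflection w) : LinearMap.det (w : (Fin 4 → ℂ) →ₗ[ℂ] (Fin 4 → ℂ)) = -1 := by
  have hsq : LinearMap.det (w : (Fin 4 → ℂ) →ₗ[ℂ] (Fin 4 → ℂ)) ^ 2 = 1 := by
    obtain ⟨σ, a, -, ha, hw⟩ := hw
    rw [det_monomial (f := (w : (Fin 4 → ℂ) →ₗ[ℂ] (Fin 4 → ℂ))) hw, mul_pow, ha]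
    norm_cast
    simp
  refine (sq_eq_one_iff.1 hsq).resolve_left fun hdet => ?_
  have htr := h.trace_eq
  rw [hdet, finrank_fin_fun] at htr
  have h1 : w = 1 := Gmpn.eq_one_of_trace_eq (by norm_num) hw (htr.trans (by norm_num))
  rw [IsReflection, h1, fixCodim_one] at h
  exact zero_ne_one h

/-- The monomial automorphism with permutation `σ` and entries `a`, indexed by rows. -/
def monomialEquiv (σ : Equiv.Perm (Fin n)) (a : Fin n → ℂˣ) : (Fin n → ℂ) ≃ₗ[ℂ] (Fin n → ℂ) where
  toFun x i := a i * x (σ⁻¹ i)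
  map_add' x y := by ext i; simp [mul_add]
  map_smul' c x := by ext i; simp [mul_left_comm]
  invFun x i := (a (σ i))⁻¹ * x (σ i)
  left_inv x := by ext i; simp
  right_inv x := by ext i; simp

theorem monomialEquiv_apply (σ : Equiv.Perm (Fin n)) (a : Fin n → ℂˣ) (x : Fin n → ℂ) (i : Fin n) :
    monomialEquiv σ a x i = a i * x (σ⁻¹ i) := rfl

theorem monomialEquiv_single (σ : Equiv.Perm (Fin n)) (a : Fin n → ℂˣ) (j : Fin n) :
    monomialEquiv σ a (Pi.single j 1) = (a (σ j) : ℂ) • (Pi.single (σ j) 1 : Fin n → ℂ) := by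
  ext i
  simp only [monomialEquiv_apply, Pi.single_apply, Pi.smul_apply, smul_eq_mul,
    Equiv.Perm.inv_eq_iff_eq]
  by_cases h : i = σ j <;> simp [h]

theorem monomialEquiv_mem (σ : Equiv.Perm (Fin n)) (a : Fin n → ℂˣ) (ha : ∀ i, a i ^ m = 1)
    (ha' : (∏ i, a i) ^ (m / p) = 1) : monomialEquiv σ a ∈ Gmpn m p n := by
  refine ⟨σ, fun j => a (σ j), fun i => ?_, ?_, monomialEquiv_single σ a⟩
  · simpa using congrArg Units.val (ha (σ i))
  · rw [Equiv.prod_comp σ fun i => (a i : ℂ)]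
    simpa using congrArg Units.val ha'

end Monomial

theorem coversOn_of_forall [FiniteDimensional ℂ V] {P : Set (V ≃ₗ[ℂ] V)}
    (hP : ∀ u ∈ P, ∀ v ∈ P, u⁻¹ * v ∈ P) {u w : V ≃ₗ[ℂ] V} (hu : u ∈ P) (hv : u * w ∈ P)
    (hle : fixCodim u + fixCodim w = fixCodim (u * w)) (hw : fixCodim w ≠ 0)
    (h : ∀ z ∈ P, z⁻¹ * w ∈ P → fixCodim z + fixCodim (z⁻¹ * w) = fixCodim w →
      fixCodim z = 0 ∨ fixCodim (z⁻¹ * w) = 0) :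
    CoversOn P coLe u (u * w) := by
  refine ⟨hu, hv, by rwa [coLe, inv_mul_cancel_left], fun he => ?_, fun z hz h₁ h₂ => ?_⟩
  · rw [left_eq_mul.1 he, fixCodim_one] at hw
    exact hw rfl
  · have hzw : (u⁻¹ * z)⁻¹ * w = z⁻¹ * (u * w) := by group
    unfold coLe at h₁ h₂
    have hmem : (u⁻¹ * z)⁻¹ * w ∈ P := hzw ▸ hP z hz _ hv
    refine (h (u⁻¹ * z) (hP u hu z hz) hmem (by rw [hzw]; omega)).imp (fun h0 => ?_) fun h0 => ?_
    · exact (inv_mul_eq_one.1 (eq_one_of_fixCodim_eq_zero h0)).symm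
    · rw [hzw] at h0
      exact inv_mul_eq_one.1 (eq_one_of_fixCodim_eq_zero h0)

theorem Gmpn.inv_mul_mem {m p n : ℕ} (hm : m ≠ 0) :
    ∀ u ∈ Gmpn m p n, ∀ v ∈ Gmpn m p n, u⁻¹ * v ∈ Gmpn m p n :=
  fun _ hu _ hv => Gmpn.mul_mem (Gmpn.inv_mem hm hu) hv

theorem coversOn_mul_reflection {u w : (Fin 4 → ℂ) ≃ₗ[ℂ] (Fin 4 → ℂ)} (hu : u ∈ Gmpn 4 2 4)
    (hw : w ∈ Gmpn 4 2 4) (hw1 : IsReflection w)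
    (hle : fixCodim u + fixCodim w = fixCodim (u * w)) :
    CoversOn (Gmpn 4 2 4) coLe u (u * w) := by
  unfold IsReflection at hw1
  exact coversOn_of_forall (Gmpn.inv_mul_mem (by norm_num)) hu (Gmpn.mul_mem hu hw) hle
    (by omega) fun z _ _ h => by omega

theorem coversOn_mul_of_det {u w : (Fin 4 → ℂ) ≃ₗ[ℂ] (Fin 4 → ℂ)} (hu : u ∈ Gmpn 4 2 4)
    (hw : w ∈ Gmpn 4 2 4) (hw2 : fixCodim w = 2)
    (hdet : LinearMap.det (w : (Fin 4 → ℂ) →ₗ[ℂ] (Fin 4 → ℂ)) = -1)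
    (hle : fixCodim u + fixCodim w = fixCodim (u * w)) :
    CoversOn (Gmpn 4 2 4) coLe u (u * w) := by
  refine coversOn_of_forall (Gmpn.inv_mul_mem (by norm_num)) hu (Gmpn.mul_mem hu hw) hle
    (by omega) fun z hz hz' h => ?_
  by_contra! hne
  have h₁ := Gmpn.det_eq_neg_one hz (show fixCodim z = 1 by omega)
  have h₂ := Gmpn.det_eq_neg_one hz' (show fixCodim (z⁻¹ * w) = 1 by omega)
  have hprod : (w : (Fin 4 → ℂ) →ₗ[ℂ] (Fin 4 → ℂ)) = (z : (Fin 4 → ℂ) →ₗ[ℂ] (Fin 4 → ℂ)) *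
      ((z⁻¹ * w : (Fin 4 → ℂ) ≃ₗ[ℂ] (Fin 4 → ℂ)) : (Fin 4 → ℂ) →ₗ[ℂ] (Fin 4 → ℂ)) := by
    refine LinearMap.ext fun x => ?_
    exact (LinearEquiv.congr_fun (mul_inv_cancel_left z w) x).symm
  rw [hprod, map_mul, h₁, h₂] at hdet
  norm_num at hdet

/-- The imaginary unit as a unit of `ℂ`. -/
def unitI : ℂˣ := Units.mk0 Complex.I Complex.I_ne_zero

theorem coe_unitI : (unitI : ℂ) = Complex.I := rfl

theorem coe_inv_unitI : ((unitI⁻¹ : ℂˣ) : ℂ) = -Complex.I := by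
  rw [Units.val_inv_eq_inv_val, coe_unitI, Complex.inv_I]

theorem unitI_pow_four : unitI ^ 4 = 1 := by
  ext
  simp [coe_unitI]

/-- The reflection interchanging the first two coordinate lines, with weight `c`. -/
def swapFst (c : ℂˣ) : (Fin 4 → ℂ) ≃ₗ[ℂ] (Fin 4 → ℂ) :=
  monomialEquiv (Equiv.swap 0 1) ![c⁻¹, c, 1, 1]

/-- The reflection interchanging the last two coordinate lines, with weight `c`. -/
def swapSnd (c : ℂˣ) : (Fin 4 → ℂ) ≃ₗ[ℂ] (Fin 4 → ℂ) :=
  monomialEquiv (Equiv.swap 2 3) ![1, 1, c⁻¹, c]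

theorem swapFst_apply (c : ℂˣ) (x : Fin 4 → ℂ) :
    swapFst c x = ![(c : ℂ)⁻¹ * x 1, c * x 0, x 2, x 3] := by
  ext i
  fin_cases i <;> simp [swapFst, monomialEquiv_apply, Equiv.swap_apply_def]

theorem swapSnd_apply (c : ℂˣ) (x : Fin 4 → ℂ) :
    swapSnd c x = ![x 0, x 1, (c : ℂ)⁻¹ * x 3, c * x 2] := by
  ext i
  fin_cases i <;> simp [swapSnd, monomialEquiv_apply, Equiv.swap_apply_def]

theorem swapFst_mem {c : ℂˣ} (hc : c ^ 4 = 1) : swapFst c ∈ Gmpn 4 2 4 :=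
  monomialEquiv_mem _ _ (by simp [Fin.forall_fin_succ, hc]) (by simp [Fin.prod_univ_four])

theorem swapSnd_mem {c : ℂˣ} (hc : c ^ 4 = 1) : swapSnd c ∈ Gmpn 4 2 4 :=
  monomialEquiv_mem _ _ (by simp [Fin.forall_fin_succ, hc]) (by simp [Fin.prod_univ_four])

theorem fixCodim_swapFst_le (c : ℂˣ) : fixCodim (swapFst c) ≤ 1 := by
  refine (fixCodim_le_card {![1, -(c : ℂ), 0, 0]} fun x => ?_).trans_eq (Finset.card_singleton _)
  rw [Finset.coe_singleton]
  refine Submodule.mem_span_singleton.2 ⟨(c : ℂ)⁻¹ * x 1 - x 0, ?_⟩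
  rw [swapFst_apply]
  have hc := c.ne_zero
  ext i
  fin_cases i <;> simp
  field_simp
  ring

theorem fixCodim_swapSnd_le (c : ℂˣ) : fixCodim (swapSnd c) ≤ 1 := by
  refine (fixCodim_le_card {![0, 0, 1, -(c : ℂ)]} fun x => ?_).trans_eq (Finset.card_singleton _)
  rw [Finset.coe_singleton]
  refine Submodule.mem_span_singleton.2 ⟨(c : ℂ)⁻¹ * x 3 - x 2, ?_⟩
  rw [swapSnd_apply]
  have hc := c.ne_zero
  ext i
  fin_cases i <;> simp
  field_simp
  ring

/-- The automorphism `diag(c, 1, c, 1)`. -/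
def diagEven (c : ℂˣ) : (Fin 4 → ℂ) ≃ₗ[ℂ] (Fin 4 → ℂ) :=
  monomialEquiv 1 ![c, 1, c, 1]

/-- The automorphism `diag(1, c, 1, c)`. -/
def diagOdd (c : ℂˣ) : (Fin 4 → ℂ) ≃ₗ[ℂ] (Fin 4 → ℂ) :=
  monomialEquiv 1 ![1, c, 1, c]

theorem diagEven_apply (c : ℂˣ) (x : Fin 4 → ℂ) :
    diagEven c x = ![c * x 0, x 1, c * x 2, x 3] := by
  ext i
  fin_cases i <;> simp [diagEven, monomialEquiv_apply]

theorem diagOdd_apply (c : ℂˣ) (x : Fin 4 → ℂ) :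
    diagOdd c x = ![x 0, c * x 1, x 2, c * x 3] := by
  ext i
  fin_cases i <;> simp [diagOdd, monomialEquiv_apply]

theorem diagEven_mem {c : ℂˣ} (hc : c ^ 4 = 1) : diagEven c ∈ Gmpn 4 2 4 :=
  monomialEquiv_mem _ _ (by simp [Fin.forall_fin_succ, hc])
    (by simp [Fin.prod_univ_four, ← sq, ← pow_mul, hc])

theorem diagOdd_mem {c : ℂˣ} (hc : c ^ 4 = 1) : diagOdd c ∈ Gmpn 4 2 4 :=
  monomialEquiv_mem _ _ (by simp [Fin.forall_fin_succ, hc])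
    (by simp [Fin.prod_univ_four, ← sq, ← pow_mul, hc])

theorem fixCodim_diagEven_le (c : ℂˣ) : fixCodim (diagEven c) ≤ 2 := by
  classical
  refine (fixCodim_le_card {Pi.single 0 1, Pi.single 2 1} fun x => ?_).trans Finset.card_le_two
  rw [Finset.coe_pair]
  refine Submodule.mem_span_pair.2 ⟨c * x 0 - x 0, c * x 2 - x 2, ?_⟩
  rw [diagEven_apply]
  ext i
  fin_cases i <;> simp

theorem fixCodim_diagOdd_le (c : ℂˣ) : fixCodim (diagOdd c) ≤ 2 := by
  classical
  refine (fixCodim_le_card {Pi.single 1 1, Pi.single 3 1} fun x => ?_).trans Finset.card_le_two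
  rw [Finset.coe_pair]
  refine Submodule.mem_span_pair.2 ⟨c * x 1 - x 1, c * x 3 - x 3, ?_⟩
  rw [diagOdd_apply]
  ext i
  fin_cases i <;> simp

theorem det_diagEven (c : ℂˣ) :
    LinearMap.det (diagEven c : (Fin 4 → ℂ) →ₗ[ℂ] (Fin 4 → ℂ)) = (c : ℂ) ^ 2 := by
  rw [det_monomial (f := (diagEven c : (Fin 4 → ℂ) →ₗ[ℂ] (Fin 4 → ℂ)))
    (monomialEquiv_single 1 ![c, 1, c, 1])]
  simp [Fin.prod_univ_four, sq]

theorem det_diagOdd (c : ℂˣ) :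
    LinearMap.det (diagOdd c : (Fin 4 → ℂ) →ₗ[ℂ] (Fin 4 → ℂ)) = (c : ℂ) ^ 2 := by
  rw [det_monomial (f := (diagOdd c : (Fin 4 → ℂ) →ₗ[ℂ] (Fin 4 → ℂ)))
    (monomialEquiv_single 1 ![1, c, 1, c])]
  simp [Fin.prod_univ_four, sq]

theorem swaps_eq_diagEven_mul_diagOdd (c : ℂˣ) :
    1 * swapFst 1 * swapFst c * swapSnd 1 * swapSnd c = 1 * diagEven c * diagOdd c⁻¹ := by
  ext1 x
  simp [swapFst_apply, swapSnd_apply, diagEven_apply, diagOdd_apply]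

theorem fixCodim_diagEven_mul_diagOdd {c : ℂˣ} (hc : c ≠ 1) :
    fixCodim (1 * diagEven c * diagOdd c⁻¹) = 4 := by
  refine (fixCodim_eq_finrank fun x hx => ?_).trans (finrank_fin_fun ℂ)
  have hfix : ∀ {d : ℂˣ} {y : ℂ}, d ≠ 1 → d * y = y → y = 0 := fun hd hy =>
    (mul_left_eq_self₀.1 hy).resolve_left fun h => hd (Units.ext h)
  have h := congrFun hx
  simp only [one_mul, LinearEquiv.mul_apply, diagEven_apply, diagOdd_apply] at h
  have hc' : c⁻¹ ≠ 1 := inv_ne_one.2 hc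
  ext i
  fin_cases i
  · exact hfix hc (h 0)
  · exact hfix hc' (h 1)
  · exact hfix hc (h 2)
  · exact hfix hc' (h 3)

/-- The codimension order on `G(4,2,4)` is not a ranked poset: there is no integer-valued
function increasing by exactly one along every covering relation. -/
theorem statement14 :
    ¬ ∃ r : ((Fin 4 → ℂ) ≃ₗ[ℂ] (Fin 4 → ℂ)) → ℤ,
      ∀ u ∈ Gmpn 4 2 4, ∀ v ∈ Gmpn 4 2 4,
        CoversOn (Gmpn 4 2 4) coLe u v → r v = r u + 1 := by
  rintro ⟨r, hr⟩
  have hI : unitI ^ 4 = 1 := unitI_pow_four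
  have hI' : unitI⁻¹ ^ 4 = 1 := by rw [inv_pow, hI, inv_one]
  have hne : unitI ≠ 1 := fun h => by simpa [coe_unitI, Complex.ext_iff] using congrArg Units.val h
  have heq := swaps_eq_diagEven_mul_diagOdd unitI
  have hv := fixCodim_diagEven_mul_diagOdd hne
  have hone : (1 : (Fin 4 → ℂ) ≃ₗ[ℂ] (Fin 4 → ℂ)) ∈ Gmpn 4 2 4 := by
    simpa using Gmpn.inv_mul_mem (by norm_num) _ (swapFst_mem hI) _ (swapFst_mem hI)
  have h0 : fixCodim (1 : (Fin 4 → ℂ) ≃ₗ[ℂ] (Fin 4 → ℂ)) = 0 := fixCodim_one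
  have step : ∀ u ∈ Gmpn 4 2 4, ∀ w ∈ Gmpn 4 2 4, CoversOn (Gmpn 4 2 4) coLe u (u * w) →
      r (u * w) = r u + 1 := fun u hu w hw h => hr u hu _ (Gmpn.mul_mem hu hw) h
  have long : r (1 * swapFst 1 * swapFst unitI * swapSnd 1 * swapSnd unitI) = r 1 + 4 := by
    rw [← heq] at hv
    have m1 := swapFst_mem (one_pow 4)
    have m2 := swapFst_mem hI
    have m3 := swapSnd_mem (one_pow 4)
    have m4 := swapSnd_mem hI
    have p1 := Gmpn.mul_mem hone m1
    have p2 := Gmpn.mul_mem p1 m2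
    have p3 := Gmpn.mul_mem p2 m3
    have c1 := fixCodim_swapFst_le 1
    have c2 := fixCodim_swapFst_le unitI
    have c3 := fixCodim_swapSnd_le 1
    have c4 := fixCodim_swapSnd_le unitI
    have s1 := fixCodim_mul_le 1 (swapFst 1)
    have s2 := fixCodim_mul_le (1 * swapFst 1) (swapFst unitI)
    have s3 := fixCodim_mul_le (1 * swapFst 1 * swapFst unitI) (swapSnd 1)
    have s4 := fixCodim_mul_le (1 * swapFst 1 * swapFst unitI * swapSnd 1) (swapSnd unitI)
    rw [step _ p3 _ m4 (coversOn_mul_reflection p3 m4 (by unfold IsReflection; omega) (by omega)),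
      step _ p2 _ m3 (coversOn_mul_reflection p2 m3 (by unfold IsReflection; omega) (by omega)),
      step _ p1 _ m2 (coversOn_mul_reflection p1 m2 (by unfold IsReflection; omega) (by omega)),
      step _ hone _ m1 (coversOn_mul_reflection hone m1 (by unfold IsReflection; omega) (by omega))]
    ring
  have short : r (1 * diagEven unitI * diagOdd unitI⁻¹) = r 1 + 2 := by
    have m1 := diagEven_mem hI
    have m2 := diagOdd_mem hI'
    have p1 := Gmpn.mul_mem hone m1
    have c1 := fixCodim_diagEven_le unitI
    have c2 := fixCodim_diagOdd_le unitI⁻¹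
    have s1 := fixCodim_mul_le 1 (diagEven unitI)
    have s2 := fixCodim_mul_le (1 * diagEven unitI) (diagOdd unitI⁻¹)
    have d1 : LinearMap.det (diagEven unitI : (Fin 4 → ℂ) →ₗ[ℂ] (Fin 4 → ℂ)) = -1 := by
      rw [det_diagEven, coe_unitI, Complex.I_sq]
    have d2 : LinearMap.det (diagOdd unitI⁻¹ : (Fin 4 → ℂ) →ₗ[ℂ] (Fin 4 → ℂ)) = -1 := by
      rw [det_diagOdd, coe_inv_unitI, neg_sq, Complex.I_sq]
    rw [step _ p1 _ m2 (coversOn_mul_of_det p1 m2 (by omega) d2 (by omega)),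
      step _ hone _ m1 (coversOn_mul_of_det hone m1 (by omega) d1 (by omega))]
    ring
  rw [heq, short] at long
  omega

end
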